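/- arXiv:1509.08154 — 7 statements merged into one kernel-verified Lean document; each statement's English description precedes it below -/
import Mathlib

section
/- Let M be a bicomplete category and let F, C, W be classes of morphisms of M such that: (i) W satisfies the 2-of-3 property (for composable f, g, if two of f, g, g∘f lie in W then so does the third); (ii) the pair (C ∩ W, F) is a weak factorization system on M; and (iii) the pair (C, F ∩ W) is a weak factorization system on M. Then M, with fibrations F, cofibrations C, and weak equivalences W, is a model category; in particular all three classes are closed under retracts and the lifting and factorization axioms hold. -/
open CategoryTheory Limits

universe v u

namespace InducedModel

variable {M : Type u} [Category.{v} M]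

/-- The class of morphisms having the left lifting property with respect to
every morphism in `R`. -/
def llp (R : MorphismProperty M) : MorphismProperty M :=
  fun _ _ f => ∀ ⦃X Y : M⦄ (g : X ⟶ Y), R g → HasLiftingProperty f g

/-- The class of morphisms having the right lifting property with respect to
every morphism in `L`. -/
def rlp (L : MorphismProperty M) : MorphismProperty M :=
  fun _ _ g => ∀ ⦃X Y : M⦄ (f : X ⟶ Y), L f → HasLiftingProperty f g

/-- `(L, R)` is a weak factorization system: every morphism factors as a morphism
in `L` followed by a morphism in `R`, `L` is exactly the class of morphisms with
the left lifting property against `R`, and `R` is exactly the class of morphisms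
with the right lifting property against `L`. -/
structure IsWFS (L R : MorphismProperty M) : Prop where
  factor : ∀ ⦃X Y : M⦄ (f : X ⟶ Y),
    ∃ (Z : M) (i : X ⟶ Z) (p : Z ⟶ Y), L i ∧ R p ∧ i ≫ p = f
  left_eq : L = llp R
  right_eq : R = rlp L

/-- `W` satisfies the 2-of-3 property. -/
def TwoOfThree (W : MorphismProperty M) : Prop :=
  (∀ ⦃X Y Z : M⦄ (f : X ⟶ Y) (g : Y ⟶ Z), W f → W g → W (f ≫ g)) ∧
  (∀ ⦃X Y Z : M⦄ (f : X ⟶ Y) (g : Y ⟶ Z), W g → W (f ≫ g) → W f) ∧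
  (∀ ⦃X Y Z : M⦄ (f : X ⟶ Y) (g : Y ⟶ Z), W f → W (f ≫ g) → W g)

/-- `P` is closed under retracts (in the arrow category). -/
def RetractClosed (P : MorphismProperty M) : Prop :=
  ∀ ⦃X Y X' Y' : M⦄ (f : X ⟶ Y) (g : X' ⟶ Y'),
    (∃ (i : Arrow.mk f ⟶ Arrow.mk g) (r : Arrow.mk g ⟶ Arrow.mk f), i ≫ r = 𝟙 _) →
    P g → P f

/-- Quillen's axioms for a model category structure on a category, with
fibrations `F`, cofibrations `C` and weak equivalences `W`:
2-of-3 for `W`, closure of all three classes under retracts, lifting of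
(acyclic) cofibrations against (acyclic) fibrations, and the two
factorization axioms. -/
structure IsModelCategory (F C W : MorphismProperty M) : Prop where
  two_of_three : TwoOfThree W
  retract_fib : RetractClosed F
  retract_cof : RetractClosed C
  retract_weq : RetractClosed W
  lift_acof_fib : ∀ ⦃A B X Y : M⦄ (i : A ⟶ B) (p : X ⟶ Y),
    C i → W i → F p → HasLiftingProperty i p
  lift_cof_afib : ∀ ⦃A B X Y : M⦄ (i : A ⟶ B) (p : X ⟶ Y),
    C i → F p → W p → HasLiftingProperty i p
  fact_acof_fib : ∀ ⦃X Y : M⦄ (f : X ⟶ Y),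
    ∃ (Z : M) (i : X ⟶ Z) (p : Z ⟶ Y), C i ∧ W i ∧ F p ∧ i ≫ p = f
  fact_cof_afib : ∀ ⦃X Y : M⦄ (f : X ⟶ Y),
    ∃ (Z : M) (i : X ⟶ Z) (p : Z ⟶ Y), C i ∧ F p ∧ W p ∧ i ≫ p = f

/-- `IsWFS` implies Mathlib's `IsWeakFactorizationSystem`. -/
theorem IsWFS.isWeakFactorizationSystem {L R : MorphismProperty M} (h : IsWFS L R) :
    L.IsWeakFactorizationSystem R where
  rlp := by
    conv_rhs => rw [h.right_eq]
    rfl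
  llp := by
    conv_rhs => rw [h.left_eq]
    rfl
  hasFactorization := ⟨fun f => by
    obtain ⟨Z, i, p, hi, hp, fac⟩ := h.factor f
    exact ⟨{ Z := Z, i := i, p := p, fac := fac, hi := hi, hp := hp }⟩⟩

theorem TwoOfThree.hasTwoOutOfThreeProperty {W : MorphismProperty M} (h : TwoOfThree W) :
    W.HasTwoOutOfThreeProperty where
  comp_mem f g hf hg := h.1 f g hf hg
  of_postcomp f g hg hfg := h.2.1 f g hg hfg
  of_precomp f g hf hfg := h.2.2 f g hf hfg

theorem retractClosed_of_isStableUnderRetracts (P : MorphismProperty M)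
    [P.IsStableUnderRetracts] : RetractClosed P := by
  rintro X Y X' Y' f g ⟨i, r, hir⟩ hg
  exact P.of_retract (f := f) (g := g) { i := i, r := r, retract := hir } hg

open HomotopicalAlgebra in
/-- The Mathlib model category structure determined by two weak factorization systems. -/
@[reducible]
def modelCategoryOfIsWFS [HasLimits M] [HasColimits M] {F C W : MorphismProperty M}
    (h23 : TwoOfThree W) (hwfs₁ : IsWFS (C ⊓ W) F) (hwfs₂ : IsWFS C (F ⊓ W)) :
    ModelCategory M :=
  letI : CategoryWithFibrations M := ⟨F⟩
  letI : CategoryWithCofibrations M := ⟨C⟩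
  letI : CategoryWithWeakEquivalences M := ⟨W⟩
  haveI : (weakEquivalences M).HasTwoOutOfThreeProperty := h23.hasTwoOutOfThreeProperty
  haveI : (trivialCofibrations M).IsWeakFactorizationSystem (fibrations M) :=
    hwfs₁.isWeakFactorizationSystem
  haveI : (cofibrations M).IsWeakFactorizationSystem (trivialFibrations M) :=
    hwfs₂.isWeakFactorizationSystem
  ModelCategory.mk' M

/-- **Proposition 2.1.2 (Joyal–Tierney).** If `M` is a bicomplete category and
`F`, `C`, `W` are classes of morphisms such that `W` satisfies 2-of-3 and
`(C ⊓ W, F)` and `(C, F ⊓ W)` are weak factorization systems, then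
`(M, F, C, W)` is a model category. -/
theorem isModelCategory_of_wfs
    [HasLimits M] [HasColimits M]
    (F C W : MorphismProperty M)
    (h23 : TwoOfThree W)
    (hwfs₁ : IsWFS (C ⊓ W) F)
    (hwfs₂ : IsWFS C (F ⊓ W)) :
    IsModelCategory F C W := by
  let m := modelCategoryOfIsWFS h23 hwfs₁ hwfs₂
  have hF : F.IsStableUnderRetracts := m.cm3b
  have hC : C.IsStableUnderRetracts := m.cm3c
  have hW : W.IsStableUnderRetracts := m.cm3a
  have := hwfs₁.isWeakFactorizationSystem
  have := hwfs₂.isWeakFactorizationSystem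
  exact
    { two_of_three := h23
      retract_fib := retractClosed_of_isStableUnderRetracts F
      retract_cof := retractClosed_of_isStableUnderRetracts C
      retract_weq := retractClosed_of_isStableUnderRetracts W
      lift_acof_fib := fun _ _ _ _ i p hi hi' hp =>
        MorphismProperty.hasLiftingProperty_of_wfs (W₁ := C ⊓ W) (W₂ := F) i p ⟨hi, hi'⟩ hp
      lift_cof_afib := fun _ _ _ _ i p hi hp hp' =>
        MorphismProperty.hasLiftingProperty_of_wfs (W₁ := C) (W₂ := F ⊓ W) i p hi ⟨hp, hp'⟩
      fact_acof_fib := fun _ _ f => by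
        obtain ⟨Z, i, p, hi, hp, fac⟩ := hwfs₁.factor f
        exact ⟨Z, i, p, hi.1, hi.2, hp, fac⟩
      fact_cof_afib := fun _ _ f => by
        obtain ⟨Z, i, p, hi, hp, fac⟩ := hwfs₂.factor f
        exact ⟨Z, i, p, hi, hp.1, hp.2, fac⟩ }

end InducedModel
end

section
/- Let (M, F, C, W) be a model category, let C' be a bicomplete category, and let L : M ⇄ C' : U be an adjunction with L left adjoint to U. Write U⁻¹F, U⁻¹W, U⁻¹(F ∩ W) for the classes of morphisms of C' carried by U into F, W, F ∩ W respectively, and llp(X) for the class of morphisms having the left lifting property with respect to every morphism of X. Assume that the pairs (llp(U⁻¹F), U⁻¹F) and (llp(U⁻¹(F ∩ W)), U⁻¹(F ∩ W)) are weak factorization systems on C'. Then C' admits a model structure with fibrations U⁻¹F, weak equivalences U⁻¹W, and cofibrations llp(U⁻¹(F ∩ W)) if and only if llp(U⁻¹F) ⊆ U⁻¹W. -/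
open CategoryTheory Limits

universe v₁ u₁ v₂ u₂ v₃ u₃ v₄ u₄

namespace InducedModel

lemma RetractClosed.of_retractArrow {C : Type*} [Category* C] {P : MorphismProperty C}
    (hP : RetractClosed P) {X Y X' Y' : C} {f : X ⟶ Y} {g : X' ⟶ Y'}
    (h : RetractArrow f g) (hg : P g) : P f :=
  hP f g ⟨h.i, h.r, h.retract⟩ hg

lemma retractClosed_llp {C : Type*} [Category* C] (R : MorphismProperty C) :
    RetractClosed (llp R) := by
  rintro X Y X' Y' f g ⟨i, r, h⟩ hg A B p hp
  have := hg p hp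
  have hfg : RetractArrow f g := ⟨i, r, h⟩
  exact hfg.leftLiftingProperty p

lemma RetractClosed.inverseImage {C D : Type*} [Category* C] [Category* D]
    {P : MorphismProperty D} (hP : RetractClosed P) (U : C ⥤ D) :
    RetractClosed (P.inverseImage U) := by
  rintro X Y X' Y' f g ⟨i, r, h⟩ hg
  have hfg : RetractArrow f g := ⟨i, r, h⟩
  exact hP.of_retractArrow (hfg.map U) hg

lemma TwoOfThree.inverseImage {C D : Type*} [Category* C] [Category* D]
    {P : MorphismProperty D} (hP : TwoOfThree P) (U : C ⥤ D) :
    TwoOfThree (P.inverseImage U) := by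
  simp only [TwoOfThree, MorphismProperty.inverseImage_iff, Functor.map_comp]
  exact ⟨fun _ _ _ f g ↦ hP.1 (U.map f) (U.map g), fun _ _ _ f g ↦ hP.2.1 (U.map f) (U.map g),
    fun _ _ _ f g ↦ hP.2.2 (U.map f) (U.map g)⟩

lemma llp_antitone {C : Type*} [Category* C] {R R' : MorphismProperty C} (h : R ≤ R') :
    llp R' ≤ llp R :=
  fun _ _ _ hf _ _ g hg ↦ hf g (h g hg)

/-- **Right-induced model structure criterion.** Given a model category
`(M, F, C, W)`, a bicomplete category `C'`, and an adjunction `L ⊣ U` with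
`U : C' ⥤ M`, such that the right-induced weak factorization systems exist on
`C'`, the right-induced model structure (fibrations `U⁻¹F`, weak equivalences
`U⁻¹W`, cofibrations `llp (U⁻¹(F ⊓ W))`) exists on `C'` if and only if
`llp (U⁻¹F) ⊆ U⁻¹W`. -/
theorem rightInduced_iff_acyclicity
    {M : Type u₁} [Category.{v₁} M] [HasLimits M] [HasColimits M]
    {C' : Type u₂} [Category.{v₂} C'] [HasLimits C'] [HasColimits C']
    (F C W : MorphismProperty M)
    (hM : IsModelCategory F C W)
    (L : M ⥤ C') (U : C' ⥤ M) (adj : L ⊣ U)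
    (hwfs₁ : IsWFS (llp (F.inverseImage U)) (F.inverseImage U))
    (hwfs₂ : IsWFS (llp ((F ⊓ W).inverseImage U)) ((F ⊓ W).inverseImage U)) :
    IsModelCategory (F.inverseImage U) (llp ((F ⊓ W).inverseImage U))
        (W.inverseImage U) ↔
      llp (F.inverseImage U) ≤ W.inverseImage U := by
  constructor
  · intro hC' X Y f hf
    obtain ⟨Z, j, p, -, hj, hp, rfl⟩ := hC'.fact_acof_fib f
    have := hf p hp
    exact hC'.retract_weq.of_retractArrow (RetractArrow.ofLeftLiftingProperty rfl) hj
  · intro hacyclic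
    have two_of_three := hM.two_of_three.inverseImage U
    exact
      { two_of_three := two_of_three
        retract_fib := hM.retract_fib.inverseImage U
        retract_cof := retractClosed_llp _
        retract_weq := hM.retract_weq.inverseImage U
        lift_acof_fib := by
          intro A B X Y i p hi hiW hp
          obtain ⟨Z, j, q, hj, hq, rfl⟩ := hwfs₁.factor i
          have := hi q ⟨hq, two_of_three.2.2 j q (hacyclic j hj) hiW⟩
          exact (retractClosed_llp (F.inverseImage U)).of_retractArrow
            (RetractArrow.ofLeftLiftingProperty rfl) hj p hp
        lift_cof_afib := fun _ _ _ _ _ p hi hp hpW ↦ hi p ⟨hp, hpW⟩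
        fact_acof_fib := by
          intro X Y f
          obtain ⟨Z, i, p, hi, hp, hfac⟩ := hwfs₁.factor f
          exact ⟨Z, i, p, llp_antitone (fun _ _ _ h ↦ h.1) i hi, hacyclic i hi, hp, hfac⟩
        fact_cof_afib := by
          intro X Y f
          obtain ⟨Z, i, p, hi, hp, hfac⟩ := hwfs₂.factor f
          exact ⟨Z, i, p, hi, hp.1, hp.2, hfac⟩ }

end InducedModel
end

section
/- Let M be a model category with cofibrations C and weak equivalences W, let K be a bicomplete category, and let V : K ⇄ M : R be an adjunction with V left adjoint to R. Assume: (1) for every object X of K there is a morphism ε_X : QX → X in K such that V(ε_X) is a weak equivalence and V(QX) is a cofibrant object of M; (2) for every morphism f : X → Y in K there is a morphism Qf : QX → QY with ε_Y ∘ Qf = f ∘ ε_X; (3) for every object X of K the fold map QX ⊔ QX → QX factors in K as a morphism j : QX ⊔ QX → Cyl(QX) followed by p : Cyl(QX) → QX, where V(j) is a cofibration and V(p) is a weak equivalence in M. Then every morphism f of K having the right lifting property with respect to all morphisms g of K with V(g) a cofibration satisfies: V(f) is a weak equivalence (i.e., the acyclicity condition rlp(V⁻¹C) ⊆ V⁻¹W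 holds). -/
open CategoryTheory Limits

universe v₁ u₁ v₂ u₂ v₃ u₃ v₄ u₄

namespace InducedModel

section

variable {M : Type u₁} [Category.{v₁} M]

lemma RetractClosed.of_maps {P : MorphismProperty M} (hP : RetractClosed P)
    {X Y X' Y' : M} {f : X ⟶ Y} {g : X' ⟶ Y'}
    (a : X ⟶ X') (b : Y ⟶ Y') (c : X' ⟶ X) (d : Y' ⟶ Y)
    (hab : a ≫ g = f ≫ b) (hcd : c ≫ f = g ≫ d)
    (hac : a ≫ c = 𝟙 X) (hbd : b ≫ d = 𝟙 Y) (hg : P g) : P f :=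
  hP f g ⟨Arrow.homMk a b hab, Arrow.homMk c d hcd, by ext <;> simp [hac, hbd]⟩ hg

namespace IsModelCategory

variable {F C W : MorphismProperty M}

lemma weq_id (hM : IsModelCategory F C W) (X : M) : W (𝟙 X) := by
  obtain ⟨Z, i, p, -, hi, -, hip⟩ := hM.fact_acof_fib (𝟙 X)
  exact hM.retract_weq.of_maps (𝟙 X) i (𝟙 X) p (by simp) (by simp [hip]) (by simp) hip hi

/-- A morphism with the right lifting property against cofibrations is a weak equivalence. -/
lemma weq_of_rlp_cof (hM : IsModelCategory F C W) {X Y : M} (q : X ⟶ Y) (hq : rlp C q) :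
    W q := by
  obtain ⟨N, c, w, hc, -, hw, hcw⟩ := hM.fact_cof_afib q
  have := hq c hc
  have sq : CommSq (𝟙 X) c q w := ⟨by simp [hcw]⟩
  exact hM.retract_weq.of_maps c (𝟙 Y) sq.lift (𝟙 Y) (by simp [hcw]) (by simp)
    sq.fac_left (by simp) hw

/-- Acyclic fibrations are sent to weak equivalences by base change. -/
lemma weq_pullback_fst (hM : IsModelCategory F C W) {X Y Z : M} (v : X ⟶ Z) (p : Y ⟶ Z)
    [HasPullback v p] (hF : F p) (hW : W p) : W (pullback.fst v p) := by
  refine hM.weq_of_rlp_cof _ fun A B c hc => ?_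
  have := hM.lift_cof_afib c p hc hF hW
  exact (IsPullback.of_hasPullback v p).flip.hasLiftingProperty c

/-- A split epimorphism `v` is a weak equivalence as soon as some composite `v ≫ h` is. -/
lemma weq_of_section (hM : IsModelCategory F C W) {Z E D : M} (v : Z ⟶ E) (s : E ⟶ Z)
    (hs : s ≫ v = 𝟙 E) (h : E ⟶ D) (hvh : W (v ≫ h)) : W v := by
  have hvs : W (v ≫ s) := hM.two_of_three.2.1 (v ≫ s) (v ≫ h) hvh
    (by simpa [reassoc_of% hs] using hvh)
  exact hM.retract_weq.of_maps (𝟙 Z) s (𝟙 Z) v (by simp) (by simp [hs]) (by simp) hs hvs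

/-- The 2-of-6 property of weak equivalences, for the middle morphism. -/
lemma weq_of_two_of_six (hM : IsModelCategory F C W) [HasPullbacks M] {A B X Y : M}
    (f : A ⟶ B) (g : B ⟶ X) (h : X ⟶ Y) (hfg : W (f ≫ g)) (hgh : W (g ≫ h)) : W g := by
  obtain ⟨Z, u, v, -, hu, hv, rfl⟩ := hM.fact_acof_fib g
  obtain ⟨E, i, p, hiC, hiW, hp, hip⟩ := hM.fact_acof_fib (f ≫ u ≫ v)
  have hpW : W p := hM.two_of_three.2.2 i p hiW (by rwa [hip])
  have hvh : W (v ≫ h) := hM.two_of_three.2.2 u _ hu (by rwa [← Category.assoc])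
  have := hM.lift_acof_fib i v hiC hiW hv
  have sq : CommSq (f ≫ u) i v p := ⟨by simp [hip]⟩
  have hq := hM.weq_pullback_fst v p hp hpW
  have hsnd : W (pullback.snd v p) :=
    hM.weq_of_section _ (pullback.lift sq.lift (𝟙 E) (by rw [sq.fac_right, Category.id_comp]))
      (pullback.lift_snd _ _ _) (p ≫ h) (by
      rw [← pullback.condition_assoc]
      exact hM.two_of_three.1 _ _ hq hvh)
  refine hM.two_of_three.1 _ _ hu (hM.two_of_three.2.2 (pullback.fst v p) v hq ?_)
  rw [pullback.condition]
  exact hM.two_of_three.1 _ _ hsnd hpW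

end IsModelCategory

/-- A left adjoint sends `⊥ ⟶ A` to a cofibration if it sends `A` to a cofibrant object. -/
lemma RetractClosed.map_initial_to {K : Type u₂} [Category.{v₂} K] [HasInitial K] [HasInitial M]
    {C : MorphismProperty M} (hC : RetractClosed C) {V : K ⥤ M} {R : M ⥤ K} (adj : V ⊣ R)
    {A : K} (hA : C (initial.to (V.obj A))) : C (V.map (initial.to A)) := by
  have := adj.leftAdjoint_preservesColimits
  have hV : IsInitial (V.obj (⊥_ K)) := initialIsInitial.isInitialObj V
  exact hC.of_maps (hV.to _) (𝟙 _) (initial.to _) (𝟙 _) (hV.hom_ext _ _)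
    (initialIsInitial.hom_ext _ _) (hV.hom_ext _ _) (by simp) hA

end

/-- **Theorem 2.2.1 (acyclicity via underlying-cofibrant replacements and
cylinders).** Let `(M, F, C, W)` be a model category, `K` a bicomplete
category, and `V ⊣ R` an adjunction with `V : K ⥤ M`. Suppose that
(1) every object `X` of `K` admits a morphism `ε X : Q X ⟶ X` such that
`V (ε X)` is a weak equivalence and `V (Q X)` is cofibrant,
(2) every morphism `f : X ⟶ Y` of `K` admits a morphism `Qf : Q X ⟶ Q Y` with
`ε Y ∘ Qf = f ∘ ε X`, and
(3) for every `X` the fold map `Q X ⨿ Q X ⟶ Q X` factors as a morphism `j`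
followed by a morphism `p`, where `V j` is a cofibration and `V p` is a weak
equivalence.
Then every morphism of `K` with the right lifting property against all
morphisms sent by `V` to cofibrations is sent by `V` to a weak equivalence. -/
theorem acyclicity_of_cylinder
    {M : Type u₁} [Category.{v₁} M] [HasLimits M] [HasColimits M]
    {K : Type u₂} [Category.{v₂} K] [HasLimits K] [HasColimits K]
    (F C W : MorphismProperty M)
    (hM : IsModelCategory F C W)
    (V : K ⥤ M) (R : M ⥤ K) (adj : V ⊣ R)
    (Q : K → K) (ε : ∀ X : K, Q X ⟶ X)
    (h1 : ∀ X : K, W (V.map (ε X)) ∧ C (initial.to (V.obj (Q X))))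
    (h2 : ∀ ⦃X Y : K⦄ (f : X ⟶ Y), ∃ Qf : Q X ⟶ Q Y, Qf ≫ ε Y = ε X ≫ f)
    (h3 : ∀ X : K, ∃ (Cyl : K) (j : Q X ⨿ Q X ⟶ Cyl) (p : Cyl ⟶ Q X),
      C (V.map j) ∧ W (V.map p) ∧ j ≫ p = coprod.desc (𝟙 (Q X)) (𝟙 (Q X)))
    ⦃X Y : K⦄ (f : X ⟶ Y)
    (hf : ∀ ⦃A B : K⦄ (g : A ⟶ B), C (V.map g) → HasLiftingProperty g f) :
    W (V.map f) := by
  obtain ⟨two_comp, two_left, two_right⟩ := hM.two_of_three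
  obtain ⟨Qf, hQf⟩ := h2 f
  have := hf _ (hM.retract_cof.map_initial_to adj (h1 Y).2)
  have sq : CommSq (initial.to X) (initial.to (Q Y)) f (ε Y) :=
    ⟨initialIsInitial.hom_ext _ _⟩
  obtain ⟨s, hs⟩ : ∃ s : Q Y ⟶ X, s ≫ f = ε Y := ⟨sq.lift, sq.fac_right⟩
  obtain ⟨Cyl, j, p, hj, hp, hjp⟩ := h3 X
  have := hf j hj
  have sq' : CommSq (coprod.desc (Qf ≫ s) (ε X)) j f (p ≫ ε X ≫ f) :=
    ⟨by ext <;> simp [hs, hQf, reassoc_of% hjp]⟩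
  have hl : (coprod.inl ≫ j) ≫ p = 𝟙 (Q X) := by
    rw [Category.assoc, hjp, coprod.inl_desc]
  have hr : (coprod.inr ≫ j) ≫ p = 𝟙 (Q X) := by
    rw [Category.assoc, hjp, coprod.inr_desc]
  have weq_of_section_p (i : Q X ⟶ Cyl) (hi : i ≫ p = 𝟙 (Q X)) : W (V.map i) :=
    two_left _ (V.map p) hp (by rw [← V.map_comp, hi, V.map_id]; exact hM.weq_id _)
  have hH : W (V.map sq'.lift) := two_right _ _ (weq_of_section_p _ hr) (by
    rw [← V.map_comp, Category.assoc, sq'.fac_left, coprod.inr_desc]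
    exact (h1 X).1)
  have hQs : W (V.map Qf ≫ V.map s) := by
    have := two_comp _ _ (weq_of_section_p _ hl) hH
    rwa [← V.map_comp, Category.assoc, sq'.fac_left, coprod.inl_desc, V.map_comp] at this
  have hsf : W (V.map s ≫ V.map f) := by
    rw [← V.map_comp, hs]
    exact (h1 Y).1
  exact two_right _ _ (hM.weq_of_two_of_six _ _ _ hQs hsf) hsf

end InducedModel
end

section
/- In any model category, the class of weak equivalences satisfies the 2-of-6 property: for any composable triple of morphisms f : A → B, g : B → C, h : C → D, if g∘f and h∘g are weak equivalences, then f, g, h, and h∘g∘f are all weak equivalences. -/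
open CategoryTheory Limits

universe v₁ u₁ v₂ u₂ v₃ u₃ v₄ u₄

namespace HomotopicalAlgebra

variable {C : Type*} [Category* C] [ModelCategory C] {H : Type*} [Category* H]
  (L : C ⥤ H) [L.IsLocalization (weakEquivalences C)]

lemma weakEquivalence_of_isIso_map_of_fibration {X Y : C} (p : X ⟶ Y)
    [IsCofibrant X] [IsFibrant X] [IsCofibrant Y] [IsFibrant Y] [Fibration p]
    [IsIso (L.map p)] : WeakEquivalence p := by
  obtain ⟨s, hs⟩ := map_surjective_of_isLocalization L (X := Y) (Y := X) (inv (L.map p))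
  obtain ⟨P, ⟨h⟩⟩ := (LeftHomotopyRel.iff_map_eq L (f := s ≫ p) (g := 𝟙 Y)).2 (by simp [hs])
  obtain ⟨Q, _, ⟨k⟩⟩ := h.exists_good_cylinder
  obtain ⟨t, k', hk'⟩ := k.covering_homotopy p s rfl
  have ht : t ≫ p = 𝟙 Y := by rw [← k'.h₁, Category.assoc, hk', k.h₁]
  have hLt : L.map t = inv (L.map p) := by
    rw [← cancel_mono (L.map p), ← L.map_comp, ht, L.map_id, IsIso.inv_hom_id]
  obtain ⟨R, ⟨l⟩⟩ := (LeftHomotopyRel.iff_map_eq L (f := p ≫ t) (g := 𝟙 X)).2 (by simp [hLt])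
  have hpt : WeakEquivalence (p ≫ t) := l.weakEquivalence_iff.2 inferInstance
  rw [weakEquivalence_iff] at hpt ⊢
  refine MorphismProperty.of_retract (g := p ≫ t) (P := weakEquivalences C) ?_ hpt
  exact { i := Arrow.homMk (𝟙 X) t
          r := Arrow.homMk (𝟙 X) p (by simp [ht])
          retract := by ext <;> simp [ht] }

lemma weakEquivalence_of_isIso_map_of_isCofibrant_of_isFibrant {X Y : C} (f : X ⟶ Y)
    [IsCofibrant X] [IsCofibrant Y] [IsFibrant Y]
    [IsIso (L.map f)] : WeakEquivalence f := by
  let d := MorphismProperty.factorizationData (trivialCofibrations C) (fibrations C) f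
  have := isCofibrant_of_cofibration d.i
  have := isFibrant_of_fibration d.p
  have : IsIso (L.map d.i) :=
    Localization.inverts L (weakEquivalences C) _ d.hi.2
  have : IsIso (L.map d.p) := by
    have : IsIso (L.map d.i ≫ L.map d.p) := by rwa [← L.map_comp, d.fac]
    exact IsIso.of_isIso_comp_left (L.map d.i) _
  have := weakEquivalence_of_isIso_map_of_fibration L d.p
  rw [← d.fac]
  infer_instance

/-- Weak equivalences in a model category are saturated. -/
lemma weakEquivalence_of_isIso_map {X Y : C} (f : X ⟶ Y) [IsIso (L.map f)] :
    WeakEquivalence f := by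
  obtain ⟨X', _, q, _, _⟩ := CofibrantObject.HoCat.exists_resolution X
  let d := MorphismProperty.factorizationData (cofibrations C) (trivialFibrations C) (q ≫ f)
  have := isCofibrant_of_cofibration d.i
  let j := FibrantObject.HoCat.iResolutionObj d.Z
  have := isCofibrant_of_cofibration j
  have hW {U V : C} (w : U ⟶ V) [WeakEquivalence w] : IsIso (L.map w) :=
    Localization.inverts L (weakEquivalences C) _ (by rwa [← weakEquivalence_iff])
  have := hW q
  have := hW d.p
  have := hW j
  have : IsIso (L.map d.i) := by
    have : IsIso (L.map d.i ≫ L.map d.p) := by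
      rw [← L.map_comp, d.fac, L.map_comp]
      infer_instance
    exact IsIso.of_isIso_comp_right _ (L.map d.p)
  have : IsIso (L.map (d.i ≫ j)) := by
    rw [L.map_comp]
    infer_instance
  have := weakEquivalence_of_isIso_map_of_isCofibrant_of_isFibrant L (d.i ≫ j)
  have := weakEquivalence_of_postcomp d.i j
  have : WeakEquivalence (q ≫ f) := by
    rw [← d.fac]
    infer_instance
  exact weakEquivalence_of_precomp q f

lemma weakEquivalence_of_comp_of_comp {X Y Z T : C} (f : X ⟶ Y) (g : Y ⟶ Z) (h : Z ⟶ T)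
    [hfg : WeakEquivalence (f ≫ g)] [hgh : WeakEquivalence (g ≫ h)] :
    WeakEquivalence g := by
  let L := (weakEquivalences C).Q
  rw [weakEquivalence_iff] at hfg hgh
  have hfg' := Localization.inverts L (weakEquivalences C) _ hfg
  have hgh' := Localization.inverts L (weakEquivalences C) _ hgh
  rw [L.map_comp] at hfg' hgh'
  have : Mono (L.map g) := mono_of_mono (L.map g) (L.map h)
  have : IsSplitEpi (L.map g) :=
    ⟨⟨⟨inv (L.map f ≫ L.map g) ≫ L.map f, by simp [-IsIso.inv_comp]⟩⟩⟩
  have : IsIso (L.map g) := isIso_of_mono_of_isSplitEpi _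
  exact weakEquivalence_of_isIso_map L g

end HomotopicalAlgebra

namespace InducedModel

open HomotopicalAlgebra

/-- The bundled model category structure given by Quillen's axioms. -/
abbrev IsModelCategory.toModelCategory {M : Type u₁} [Category.{v₁} M]
    [HasFiniteLimits M] [HasFiniteColimits M]
    {F C W : MorphismProperty M} (hM : IsModelCategory F C W) : ModelCategory M :=
  { categoryWithFibrations := ⟨F⟩
    categoryWithCofibrations := ⟨C⟩
    categoryWithWeakEquivalences := ⟨W⟩
    cm2 :=
      { comp_mem f g := hM.two_of_three.1 f g
        of_postcomp f g := hM.two_of_three.2.1 f g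
        of_precomp f g := hM.two_of_three.2.2 f g }
    cm3a := ⟨fun {_ _ _ _ f g} r hg ↦ hM.retract_weq f g ⟨r.i, r.r, r.retract⟩ hg⟩
    cm3b := ⟨fun {_ _ _ _ f g} r hg ↦ hM.retract_fib f g ⟨r.i, r.r, r.retract⟩ hg⟩
    cm3c := ⟨fun {_ _ _ _ f g} r hg ↦ hM.retract_cof f g ⟨r.i, r.r, r.retract⟩ hg⟩
    cm4a i p hi hw hp := hM.lift_acof_fib i p hi.mem hw.mem hp.mem
    cm4b i p hi hp hw := hM.lift_cof_afib i p hi.mem hp.mem hw.mem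
    cm5a := ⟨fun f ↦ by
      obtain ⟨Z, i, p, hi, hw, hp, fac⟩ := hM.fact_acof_fib f
      exact ⟨{ Z := Z, i := i, p := p, hi := ⟨hi, hw⟩, hp := hp, fac := fac }⟩⟩
    cm5b := ⟨fun f ↦ by
      obtain ⟨Z, i, p, hi, hp, hw, fac⟩ := hM.fact_cof_afib f
      exact ⟨{ Z := Z, i := i, p := p, hi := hi, hp := ⟨hp, hw⟩, fac := fac }⟩⟩ }

/-- **2-of-6 property.** In any model category, for any composable triple
`f, g, h`, if `g ≫ f`-style composites `f ≫ g` and `g ≫ h` are weak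
equivalences, then so are `f`, `g`, `h` and `f ≫ g ≫ h`. -/
theorem two_of_six
    {M : Type u₁} [Category.{v₁} M] [HasLimits M] [HasColimits M]
    (F C W : MorphismProperty M)
    (hM : IsModelCategory F C W)
    ⦃A B B' D : M⦄ (f : A ⟶ B) (g : B ⟶ B') (h : B' ⟶ D)
    (hgf : W (f ≫ g)) (hhg : W (g ≫ h)) :
    W f ∧ W g ∧ W h ∧ W (f ≫ g ≫ h) := by
  let _ := hM.toModelCategory
  have : WeakEquivalence (f ≫ g) := ⟨hgf⟩
  have : WeakEquivalence (g ≫ h) := ⟨hhg⟩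
  have hg : W g := (weakEquivalence_of_comp_of_comp f g h).mem
  obtain ⟨comp, of_postcomp, of_precomp⟩ := hM.two_of_three
  have hf : W f := of_postcomp f g hg hgf
  exact ⟨hf, hg, of_precomp g h hg hhg, comp f (g ≫ h) hf hhg⟩

end InducedModel
end

section
/- Consider bicomplete categories K, M, N, P and four adjunctions: V₁ : M → K with right adjoint R₁ : K → M; U₁ : N → K with left adjoint L₁ : K → N; U₂ : P → M with left adjoint L₂ : M → P; and V₂ : P → N with right adjoint R₂ : N → P. Suppose K carries a model structure (F, C, W); suppose N carries the right-induced model structure created by U₁ (fibrations U₁⁻¹F, weak equivalences U₁⁻¹W, cofibrations llp(U₁⁻¹(F ∩ W))); suppose M carries the left-induced model structure created by V₁ (cofibrations V₁⁻¹C, weak equivalences V₁⁻¹W, fibrations rlp(V₁⁻¹(C ∩ W))). Assume the natural isomorphisms U₁ ∘ V₂ ≅ V₁ ∘ U₂ and U₂ ∘ R₂ ≅ R₁ ∘ U₁. Then every morphism f of P that has the left lifting property with respect to all morphisms g of P with U₂(g) a fibration of M satisfies: V₂(f) is an acyclic cofibration of N, i.e., V₂(f) is both a cofibration and a weak equivalence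 in the right-induced model structure on N. Dually, every morphism f of P that has the right lifting property with respect to all morphisms g of P with V₂(g) a cofibration of N satisfies: U₂(f) is an acyclic fibration of M. -/
open CategoryTheory Limits

universe v₁ u₁ v₂ u₂ v₃ u₃ v₄ u₄

namespace InducedModel

/-- The retract argument for acyclic cofibrations. -/
lemma IsModelCategory.acof_of_hasLiftingProperty {M : Type u₁} [Category.{v₁} M]
    {F C W : MorphismProperty M}
    (h : IsModelCategory F C W) {X Y : M} (f : X ⟶ Y) (hf : llp F f) : C f ∧ W f := by
  obtain ⟨Z, i, p, hCi, hWi, hFp, fac⟩ := h.fact_acof_fib f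
  have := hf p hFp
  let r := RetractArrow.ofLeftLiftingProperty fac
  exact ⟨h.retract_cof f i ⟨r.i, r.r, r.retract⟩ hCi,
    h.retract_weq f i ⟨r.i, r.r, r.retract⟩ hWi⟩

/-- The retract argument for acyclic fibrations. -/
lemma IsModelCategory.afib_of_hasLiftingProperty {M : Type u₁} [Category.{v₁} M]
    {F C W : MorphismProperty M}
    (h : IsModelCategory F C W) {X Y : M} (f : X ⟶ Y) (hf : rlp C f) : F f ∧ W f := by
  obtain ⟨Z, i, p, hCi, hFp, hWp, fac⟩ := h.fact_cof_afib f
  have := hf i hCi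
  let r := RetractArrow.ofRightLiftingProperty fac
  exact ⟨h.retract_fib f p ⟨r.i, r.r, r.retract⟩ hFp,
    h.retract_weq f p ⟨r.i, r.r, r.retract⟩ hWp⟩

/-- In a square of adjunctions whose right adjoints commute, lifting problems between
`M` and `N` can be transposed to `K`. -/
lemma hasLiftingProperty_map_map_iff {K : Type u₁} [Category.{v₁} K]
    {M : Type u₂} [Category.{v₂} M] {N : Type u₃} [Category.{v₃} N]
    {P : Type u₄} [Category.{v₄} P] {V₁ : M ⥤ K} {R₁ : K ⥤ M} (adj₁ : V₁ ⊣ R₁)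
    {U₁ : N ⥤ K} {U₂ : P ⥤ M} {R₂ : N ⥤ P} (iso : R₂ ⋙ U₂ ≅ U₁ ⋙ R₁)
    {A B : M} (i : A ⟶ B) {X Y : N} (g : X ⟶ Y) :
    HasLiftingProperty i (U₂.map (R₂.map g)) ↔ HasLiftingProperty (V₁.map i) (U₁.map g) := by
  rw [adj₁.hasLiftingProperty_iff]
  exact HasLiftingProperty.iff_of_arrow_iso_right i
    (Arrow.isoMk (f := Arrow.mk (U₂.map (R₂.map g))) (g := Arrow.mk (R₁.map (U₁.map g)))
      (iso.app X) (iso.app Y) (iso.hom.naturality g).symm)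

/-- **Acyclicity in an adjoint square.** In the setting of a square of
adjunctions between bicomplete categories with a model structure `(F, C, W)`
on `K`, the right-induced model structure on `N` (created by `U₁`), the
left-induced model structure on `M` (created by `V₁`), and natural
isomorphisms `U₁ ∘ V₂ ≅ V₁ ∘ U₂` and `U₂ ∘ R₂ ≅ R₁ ∘ U₁`: every morphism of
`P` with the left lifting property against all morphisms sent by `U₂` to
fibrations of `M` is sent by `V₂` to an acyclic cofibration of `N`; dually,
every morphism of `P` with the right lifting property against all morphisms
sent by `V₂` to cofibrations of `N` is sent by `U₂` to an acyclic fibration of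
`M`. -/
theorem adjoint_square_acyclicity
    {K : Type u₁} [Category.{v₁} K] [HasLimits K] [HasColimits K]
    {M : Type u₂} [Category.{v₂} M] [HasLimits M] [HasColimits M]
    {N : Type u₃} [Category.{v₃} N] [HasLimits N] [HasColimits N]
    {P : Type u₄} [Category.{v₄} P] [HasLimits P] [HasColimits P]
    (F C W : MorphismProperty K)
    (hK : IsModelCategory F C W)
    (V₁ : M ⥤ K) (R₁ : K ⥤ M) (adj₁ : V₁ ⊣ R₁)
    (L₁ : K ⥤ N) (U₁ : N ⥤ K) (adj₂ : L₁ ⊣ U₁)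
    (L₂ : M ⥤ P) (U₂ : P ⥤ M) (adj₃ : L₂ ⊣ U₂)
    (V₂ : P ⥤ N) (R₂ : N ⥤ P) (adj₄ : V₂ ⊣ R₂)
    -- the fibrations and weak equivalences of the left-induced structure on M,
    -- and the cofibrations and weak equivalences of the right-induced structure on N
    (FM WM : MorphismProperty M) (CN WN : MorphismProperty N)
    (hFM : FM = rlp ((C ⊓ W).inverseImage V₁)) (hWM : WM = W.inverseImage V₁)
    (hCN : CN = llp ((F ⊓ W).inverseImage U₁)) (hWN : WN = W.inverseImage U₁)
    -- N carries the right-induced model structure created by U₁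
    (hN : IsModelCategory (F.inverseImage U₁) CN WN)
    -- M carries the left-induced model structure created by V₁
    (hM : IsModelCategory FM (C.inverseImage V₁) WM)
    -- the natural isomorphisms U₁ ∘ V₂ ≅ V₁ ∘ U₂ and U₂ ∘ R₂ ≅ R₁ ∘ U₁
    (iso₁ : V₂ ⋙ U₁ ≅ U₂ ⋙ V₁)
    (iso₂ : R₂ ⋙ U₂ ≅ U₁ ⋙ R₁) :
    (∀ ⦃A B : P⦄ (f : A ⟶ B),
      (∀ ⦃X Y : P⦄ (g : X ⟶ Y), FM (U₂.map g) → HasLiftingProperty f g) →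
      CN (V₂.map f) ∧ WN (V₂.map f)) ∧
    (∀ ⦃A B : P⦄ (f : A ⟶ B),
      (∀ ⦃X Y : P⦄ (g : X ⟶ Y), CN (V₂.map g) → HasLiftingProperty g f) →
      FM (U₂.map f) ∧ WM (U₂.map f)) := by
  subst hFM hCN
  refine ⟨fun A B f hf ↦ hN.acof_of_hasLiftingProperty _ fun X Y g hg ↦ ?_,
    fun A B f hf ↦ hM.afib_of_hasLiftingProperty _ fun X Y i hi ↦ ?_⟩
  · rw [adj₄.hasLiftingProperty_iff]
    refine hf _ fun A' B' i hi ↦ ?_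
    rw [hasLiftingProperty_map_map_iff adj₁ iso₂]
    exact hK.lift_acof_fib _ _ hi.1 hi.2 hg
  · rw [← adj₃.hasLiftingProperty_iff]
    refine hf _ fun X' Y' g hg ↦ ?_
    rw [adj₄.hasLiftingProperty_iff, adj₃.hasLiftingProperty_iff,
      hasLiftingProperty_map_map_iff adj₁ iso₂]
    exact hK.lift_cof_afib _ _ hi hg.1 hg.2

end InducedModel
end

section
/- Let f : X → Y be a morphism of simplicial sets and |f| : |X| → |Y| the induced continuous map of geometric realizations. Then f is a monomorphism of simplicial sets (equivalently, each map f_n : X_n → Y_n is injective) if and only if the underlying function of |f| is injective. -/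
open CategoryTheory Simplicial Opposite

namespace stdSimplex

variable {ι κ : Type*} [Fintype ι] [Fintype κ]

lemma map_apply_eq_sum [DecidableEq κ] (f : ι → κ) (s : stdSimplex ℝ ι) (j : κ) :
    map f s j = ∑ i with f i = j, s i := by
  rw [map_coe, FunOnFinite.linearMap_apply_apply]

lemma map_pos_iff {f : ι → κ} {s : stdSimplex ℝ ι} (hs : ∀ i, 0 < s i) (j : κ) :
    0 < map f s j ↔ j ∈ Set.range f := by
  classical
  rw [map_apply_eq_sum, Finset.sum_pos_iff_of_nonneg fun i _ ↦ (hs i).le]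
  simp [hs]

lemma map_apply_of_injective {f : ι → κ} (hf : Function.Injective f)
    (s : stdSimplex ℝ ι) (i : ι) :
    map f s (f i) = s i := by
  classical
  simp [map_apply_eq_sum, Finset.sum_filter, hf.eq_iff]

lemma map_injective {f : ι → κ} (hf : Function.Injective f) :
    Function.Injective (map (S := ℝ) f) := by
  intro s t h
  ext i
  simpa only [map_apply_of_injective hf] using DFunLike.congr_fun h (f i)

/-- A map of finite types is determined by its effect on the interior of the simplex. -/
lemma eq_of_map_eq_of_pos {f g : ι → κ}
    (h : ∀ s : stdSimplex ℝ ι, (∀ i, 0 < s i) → map f s = map g s) : f = g := by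
  classical
  ext i
  let w (i₀ : Option ι) (j : ι) : ℝ :=
    (1 + if some j = i₀ then 1 else 0) / ∑ k, (1 + if some k = i₀ then 1 else 0)
  have hpos (i₀ : Option ι) : (0 : ℝ) < ∑ k, (1 + if some k = i₀ then 1 else 0) :=
    Finset.sum_pos (fun k _ ↦ by positivity) ⟨i, Finset.mem_univ i⟩
  have hw (i₀ : Option ι) (j : ι) : 0 < w i₀ j := div_pos (by positivity) (hpos i₀)
  have key (i₀ : Option ι) :
      (∑ j with f j = g i, (1 + if some j = i₀ then (1 : ℝ) else 0)) =
        ∑ j with g j = g i, (1 + if some j = i₀ then (1 : ℝ) else 0) := by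
    have := DFunLike.congr_fun (h ⟨w i₀, fun j ↦ (hw i₀ j).le, by
      rw [← Finset.sum_div, div_self (hpos i₀).ne']⟩ (hw i₀)) (g i)
    rw [map_apply_eq_sum, map_apply_eq_sum] at this
    change ∑ j with f j = g i, w i₀ j = ∑ j with g j = g i, w i₀ j at this
    rwa [← Finset.sum_div, ← Finset.sum_div, div_left_inj' (hpos i₀).ne'] at this
  have h₀ := key none
  have h₁ := key (some i)
  simp only [Finset.sum_add_distrib] at h₀ h₁
  by_contra hi
  simp [hi] at h₀ h₁
  simp [h₀] at h₁

/-- Every point of the simplex lies in the interior of some face. -/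
lemma exists_pos_map_orderEmb {n : ℕ} (p : stdSimplex ℝ (Fin (n + 1))) :
    ∃ (k : ℕ) (f : Fin (k + 1) ↪o Fin (n + 1)) (y : stdSimplex ℝ (Fin (k + 1))),
      (∀ i, 0 < y i) ∧ map f y = p := by
  let A : Finset (Fin (n + 1)) := {i | 0 < p i}
  have hA : A.Nonempty := by
    by_contra! hA
    have h0 (i) : p i = 0 := by
      by_contra hi
      have : i ∈ A := by simpa [A] using (zero_le p i).lt_of_ne' hi
      simp [hA] at this
    simpa [h0] using sum_eq_one p
  obtain ⟨k, hk⟩ := Nat.exists_eq_succ_of_ne_zero hA.card_ne_zero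
  let f := A.orderEmbOfFin hk
  have hf (i) : i ∈ Set.range f ↔ 0 < p i := by
    simp [f, A]
  have hp (i) (hi : i ∉ Set.range f) : p i = 0 :=
    le_antisymm (not_lt.1 fun h ↦ hi ((hf i).2 h)) (zero_le p i)
  refine ⟨k, f, ⟨p ∘ f, fun i ↦ zero_le p _, ?_⟩, fun i ↦ (hf _).1 ⟨i, rfl⟩, ?_⟩
  · rw [← sum_eq_one p]
    exact Fintype.sum_of_injective f f.injective _ _ hp fun _ ↦ rfl
  · ext j
    by_cases hj : j ∈ Set.range f
    · obtain ⟨i, rfl⟩ := hj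
      exact map_apply_of_injective f.injective _ _
    · rw [hp j hj, map_apply_eq_sum, Finset.sum_eq_zero]
      intro i hi
      exact (hj ⟨i, by simpa using hi⟩).elim

end stdSimplex

namespace SSet

universe u
variable {X Y : SSet.{u}}

/-- The point of `|X|` with barycentric coordinates `p` in the simplex `a`. -/
noncomputable def toTopMk {n : ℕ} (a : X _⦋n⦌) (p : _root_.stdSimplex ℝ (Fin (n + 1))) : |X| :=
  TopCat.toSSetObjEquiv _ _ ((sSetTopAdj.unit.app X).app _ a) p

lemma toTopMk_map {n m : ℕ} (s : ⦋n⦌ ⟶ ⦋m⦌) (a : X _⦋m⦌) (p : _root_.stdSimplex ℝ (Fin (n + 1))) :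
    toTopMk (X.map s.op a) p = toTopMk a (_root_.stdSimplex.map s p) := by
  have := NatTrans.naturality_apply (sSetTopAdj.unit.app X) s.op a
  exact DFunLike.congr_fun (congrArg (TopCat.toSSetObjEquiv _ _) this) p

lemma toTop_map_toTopMk (f : X ⟶ Y) {n : ℕ} (a : X _⦋n⦌) (p : _root_.stdSimplex ℝ (Fin (n + 1))) :
    SSet.toTop.map f (toTopMk a p) = toTopMk (f.app _ a) p := by
  have := ConcreteCategory.congr_hom
    (NatTrans.congr_app (sSetTopAdj.unit.naturality f) (op ⦋n⦌)) a
  exact DFunLike.congr_fun (congrArg (TopCat.toSSetObjEquiv _ _) this.symm) p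

/-- Morphisms to the singular simplicial set of a type with the trivial topology. -/
noncomputable def homTrivial {S : Type u} (T : ∀ n : ℕ, X _⦋n⦌ → _root_.stdSimplex ℝ (Fin (n + 1)) → S)
    (hT : ∀ {n m : ℕ} (s : ⦋n⦌ ⟶ ⦋m⦌) (a : X _⦋m⦌) (p : _root_.stdSimplex ℝ (Fin (n + 1))),
      T n (X.map s.op a) p = T m a (_root_.stdSimplex.map s p)) :
    X ⟶ TopCat.toSSet.obj (TopCat.trivial.obj S) where
  app n := ↾fun a ↦ (TopCat.toSSetObjEquiv (TopCat.trivial.obj S) n).symm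
    (@ContinuousMap.mk _ _ _ ⊤ (T n.unop.len a) continuous_top)
  naturality n m s := by
    ext a
    apply (TopCat.toSSetObjEquiv (TopCat.trivial.obj S) m).injective
    ext p
    exact hT s.unop a p

/-- A family of functions on the simplices of `X` that is compatible with the simplicial structure
descends to a function on `|X|`. -/
lemma exists_toTop_desc {S : Type u} (T : ∀ n : ℕ, X _⦋n⦌ → _root_.stdSimplex ℝ (Fin (n + 1)) → S)
    (hT : ∀ {n m : ℕ} (s : ⦋n⦌ ⟶ ⦋m⦌) (a : X _⦋m⦌) (p : _root_.stdSimplex ℝ (Fin (n + 1))),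
      T n (X.map s.op a) p = T m a (_root_.stdSimplex.map s p)) :
    ∃ g : |X| → S, ∀ (n : ℕ) (a : X _⦋n⦌) (p : _root_.stdSimplex ℝ (Fin (n + 1))),
      g (toTopMk a p) = T n a p := by
  let g := (sSetTopAdj.homEquiv _ _).symm (homTrivial T hT)
  have hg : sSetTopAdj.homEquiv _ _ g = homTrivial T hT := Equiv.apply_symm_apply _ _
  refine ⟨g, fun n a p ↦ ?_⟩
  rw [Adjunction.homEquiv_unit] at hg
  have := ConcreteCategory.congr_hom (NatTrans.congr_app hg (op ⦋n⦌)) a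
  have := DFunLike.congr_fun (congrArg (TopCat.toSSetObjEquiv _ _) this) p
  exact this

lemma exists_toTopMk (x : |X|) :
    ∃ (n : ℕ) (a : X _⦋n⦌) (p : _root_.stdSimplex ℝ (Fin (n + 1))), toTopMk a p = x := by
  let S := ULift.{u} Prop
  let g : |X| ⟶ TopCat.trivial.obj S := TopCat.adj₂.homEquiv _ _ (↾fun x ↦ ULift.up
    (∃ (n : ℕ) (a : X _⦋n⦌) (p : _root_.stdSimplex ℝ (Fin (n + 1))), toTopMk a p = x))
  let h : |X| ⟶ TopCat.trivial.obj S := TopCat.adj₂.homEquiv _ _ (↾fun _ ↦ ULift.up True)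
  have : g = h := by
    apply (sSetTopAdj.homEquiv _ _).injective
    rw [Adjunction.homEquiv_unit, Adjunction.homEquiv_unit]
    ext n a
    apply (TopCat.toSSetObjEquiv (TopCat.trivial.obj S) n).injective
    ext p
    refine congrArg ULift.up (eq_true ?_)
    exact ⟨_, a, p, rfl⟩
  exact of_eq_true (congrArg ULift.down (ConcreteCategory.congr_hom this x))


lemma exists_epi_mono_fac {n m : ℕ} (f : ⦋n⦌ ⟶ ⦋m⦌) :
    ∃ (k : ℕ) (e : ⦋n⦌ ⟶ ⦋k⦌) (i : ⦋k⦌ ⟶ ⦋m⦌), Epi e ∧ Mono i ∧ e ≫ i = f :=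
  ⟨(Limits.image f).len, Limits.factorThruImage f, Limits.image.ι f,
    inferInstanceAs (Epi (Limits.factorThruImage f)), inferInstanceAs (Mono (Limits.image.ι f)),
    Limits.image.fac f⟩

/-- Points of the nondegenerate simplices of `X`. -/
abbrev NonDegeneratePoint (X : SSet.{u}) : Type u :=
  Σ n : ℕ, X.nonDegenerate n × _root_.stdSimplex ℝ (Fin (n + 1))

/-- `c` is the normal form of the point with coordinates `p` in the simplex `a`:
it is obtained by restricting `a` to a simplex containing `p` in its interior and then
collapsing to a nondegenerate simplex. -/
def IsNormalForm {n : ℕ} (a : X _⦋n⦌) (p : _root_.stdSimplex ℝ (Fin (n + 1)))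
    (c : X.NonDegeneratePoint) : Prop :=
  ∃ (k : ℕ) (i : ⦋k⦌ ⟶ ⦋n⦌) (y : _root_.stdSimplex ℝ (Fin (k + 1))) (e : ⦋k⦌ ⟶ ⦋c.1⦌),
    (∀ j, 0 < y j) ∧ _root_.stdSimplex.map i y = p ∧ Epi e ∧
      X.map i.op a = X.map e.op c.2.1 ∧ _root_.stdSimplex.map e y = c.2.2

lemma map_comp_stdSimplex {n m k : ℕ} (f : ⦋n⦌ ⟶ ⦋m⦌) (g : ⦋m⦌ ⟶ ⦋k⦌)
    (p : _root_.stdSimplex ℝ (Fin (n + 1))) :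
    _root_.stdSimplex.map (f ≫ g) p = _root_.stdSimplex.map g (_root_.stdSimplex.map f p) :=
  (stdSimplex.map_comp_apply f g p).symm

lemma exists_isNormalForm {n : ℕ} (a : X _⦋n⦌) (p : _root_.stdSimplex ℝ (Fin (n + 1))) :
    ∃ c, IsNormalForm a p c := by
  obtain ⟨k, i, y, hy, rfl⟩ := stdSimplex.exists_pos_map_orderEmb p
  let i' : ⦋k⦌ ⟶ ⦋n⦌ := SimplexCategory.Hom.mk i.toOrderHom
  obtain ⟨m, e, he, z, hz⟩ := X.exists_nonDegenerate (X.map i'.op a)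
  exact ⟨⟨m, z, _root_.stdSimplex.map e y⟩, k, i', y, e, hy, rfl, he, hz, rfl⟩

lemma IsNormalForm.exists_mono {n : ℕ} {a : X _⦋n⦌} {p : _root_.stdSimplex ℝ (Fin (n + 1))}
    {c : X.NonDegeneratePoint} (h : IsNormalForm a p c) :
    ∃ (k : ℕ) (i : ⦋k⦌ ⟶ ⦋n⦌) (y : _root_.stdSimplex ℝ (Fin (k + 1))) (e : ⦋k⦌ ⟶ ⦋c.1⦌),
      Mono i ∧ (∀ j, 0 < y j) ∧ _root_.stdSimplex.map i y = p ∧ Epi e ∧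
        X.map i.op a = X.map e.op c.2.1 ∧ _root_.stdSimplex.map e y = c.2.2 := by
  obtain ⟨m, z, q⟩ := c
  obtain ⟨k, i, y, e, hy, rfl, he, hz, hq⟩ := h
  obtain ⟨l, π, i, hπ, hi, rfl⟩ := exists_epi_mono_fac i
  obtain ⟨m', e', he', z', hz'⟩ := X.exists_nonDegenerate (X.map i.op a)
  have hz'' : X.map (π ≫ i).op a = X.map (π ≫ e').op z' := by
    simp [hz']
  obtain rfl := X.unique_nonDegenerate_dim _ e z hz (π ≫ e') z' hz''
  obtain rfl := X.unique_nonDegenerate_simplex _ e z hz (π ≫ e') z' hz''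
  obtain rfl := X.unique_nonDegenerate_map _ e z hz (π ≫ e') z hz''
  refine ⟨l, i, _root_.stdSimplex.map π y, e', hi, fun j ↦ ?_, ?_, he', hz', ?_⟩
  · rw [stdSimplex.map_pos_iff hy]
    exact SimplexCategory.epi_iff_surjective.1 hπ j
  · exact (map_comp_stdSimplex _ _ _).symm
  · rw [← hq]
    exact (map_comp_stdSimplex _ _ _).symm

lemma eq_of_map_pos {k l n : ℕ} {i : ⦋k⦌ ⟶ ⦋n⦌} {j : ⦋l⦌ ⟶ ⦋n⦌} [Mono i] [Mono j]
    {y : _root_.stdSimplex ℝ (Fin (k + 1))} {z : _root_.stdSimplex ℝ (Fin (l + 1))}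
    (hy : ∀ t, 0 < y t) (hz : ∀ t, 0 < z t)
    (h : _root_.stdSimplex.map i y = _root_.stdSimplex.map j z) :
    ∃ hkl : k = l, (hkl ▸ i) = j ∧ hkl ▸ y = z := by
  have hi : Function.Injective i := SimplexCategory.mono_iff_injective.1 ‹_›
  have hj : Function.Injective j := SimplexCategory.mono_iff_injective.1 ‹_›
  have hr : Set.range i = Set.range j := by
    ext t
    rw [← stdSimplex.map_pos_iff hy, ← stdSimplex.map_pos_iff hz, h]
  obtain rfl : k = l := by
    have h1 := Set.card_range_of_injective hi
    have h2 := Set.card_range_of_injective hj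
    simp only [hr] at h1
    have := h1.symm.trans h2
    simpa using this
  obtain rfl : i = j := by
    ext t : 3
    refine congrFun (StrictMono.range_inj (f := i) (g := j) ?_ ?_ |>.1 hr) t
    · exact i.toOrderHom.monotone.strictMono_of_injective hi
    · exact j.toOrderHom.monotone.strictMono_of_injective hj
  exact ⟨rfl, rfl, stdSimplex.map_injective hi h⟩

lemma IsNormalForm.unique {n : ℕ} {a : X _⦋n⦌} {p : _root_.stdSimplex ℝ (Fin (n + 1))}
    {c c' : X.NonDegeneratePoint} (h : IsNormalForm a p c) (h' : IsNormalForm a p c') :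
    c = c' := by
  obtain ⟨m, z, q⟩ := c
  obtain ⟨m', z', q'⟩ := c'
  obtain ⟨k, i, y, e, hi, hy, hp, he, hz, hq⟩ := h.exists_mono
  obtain ⟨k', i', y', e', hi', hy', hp', he', hz', hq'⟩ := h'.exists_mono
  obtain ⟨rfl, rfl, rfl⟩ := eq_of_map_pos hy hy' (hp.trans hp'.symm)
  obtain rfl := X.unique_nonDegenerate_dim _ e z hz e' z' hz'
  obtain rfl := X.unique_nonDegenerate_simplex _ e z hz e' z' hz'
  obtain rfl := X.unique_nonDegenerate_map _ e z hz e' z hz'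
  rw [← show _ = q from hq, ← show _ = q' from hq']

lemma IsNormalForm.of_map {n m : ℕ} {s : ⦋n⦌ ⟶ ⦋m⦌} {a : X _⦋m⦌}
    {p : _root_.stdSimplex ℝ (Fin (n + 1))} {c : X.NonDegeneratePoint}
    (h : IsNormalForm (X.map s.op a) p c) :
    IsNormalForm a (_root_.stdSimplex.map s p) c := by
  obtain ⟨k, i, y, e, hy, rfl, he, hz, hq⟩ := h
  exact ⟨k, i ≫ s, y, e, hy, map_comp_stdSimplex _ _ _, he, by simpa using hz, hq⟩

lemma IsNormalForm.toTopMk_eq {n : ℕ} {a : X _⦋n⦌} {p : _root_.stdSimplex ℝ (Fin (n + 1))}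
    {c : X.NonDegeneratePoint} (h : IsNormalForm a p c) :
    toTopMk a p = toTopMk c.2.1.1 c.2.2 := by
  obtain ⟨k, i, y, e, hy, rfl, he, hz, hq⟩ := h
  rw [← hq, ← toTopMk_map, ← toTopMk_map, hz]

/-- Two points of simplices are identified in `|X|` only if they have the same normal form. -/
lemma IsNormalForm.eq_of_toTopMk_eq {n m : ℕ} {a : X _⦋n⦌} {b : X _⦋m⦌}
    {p : _root_.stdSimplex ℝ (Fin (n + 1))} {q : _root_.stdSimplex ℝ (Fin (m + 1))}
    {c d : X.NonDegeneratePoint} (hc : IsNormalForm a p c) (hd : IsNormalForm b q d)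
    (h : toTopMk a p = toTopMk b q) : c = d := by
  choose T hT using fun (n : ℕ) ↦ exists_isNormalForm (X := X) (n := n)
  obtain ⟨g, hg⟩ := exists_toTop_desc T fun s a p ↦ (hT _ _ _).of_map.unique (hT _ _ _)
  rw [hc.unique (hT _ a p), hd.unique (hT _ b q), ← hg, ← hg, h]

lemma IsNormalForm.map {f : X ⟶ Y} [Mono f] {n : ℕ} {a : X _⦋n⦌}
    {p : _root_.stdSimplex ℝ (Fin (n + 1))} {c : X.NonDegeneratePoint}
    (h : IsNormalForm a p c) :
    IsNormalForm (f.app _ a) p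
      ⟨c.1, ⟨f.app _ c.2.1, (nonDegenerate_iff_of_mono f _).2 c.2.1.2⟩, c.2.2⟩ := by
  obtain ⟨k, i, y, e, hy, rfl, he, hz, hq⟩ := h
  refine ⟨k, i, y, e, hy, rfl, he, ?_, hq⟩
  simp only [← NatTrans.naturality_apply, hz]

lemma toTop_map_injective (f : X ⟶ Y) [Mono f] : Function.Injective (SSet.toTop.map f) := by
  intro x x' h
  obtain ⟨n, a, p, rfl⟩ := exists_toTopMk x
  obtain ⟨m, b, q, rfl⟩ := exists_toTopMk x'
  rw [toTop_map_toTopMk, toTop_map_toTopMk] at h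
  obtain ⟨⟨k, z, r⟩, hc⟩ := exists_isNormalForm a p
  obtain ⟨⟨k', z', r'⟩, hd⟩ := exists_isNormalForm b q
  have := (hc.map (f := f)).eq_of_toTopMk_eq hd.map h
  rw [hc.toTopMk_eq, hd.toTopMk_eq]
  obtain rfl : k = k' := congrArg Sigma.fst this
  simp only [Sigma.mk.injEq, heq_eq_eq, true_and, Prod.mk.injEq, Subtype.mk.injEq] at this
  obtain ⟨hz, rfl⟩ := this
  have : z.1 = z'.1 := (CategoryTheory.mono_iff_injective (f.app (op ⦋k⦌))).1 inferInstance hz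
  rw [this]

lemma toTopMk_injective {n : ℕ} {a b : X _⦋n⦌} (h : ∀ p, toTopMk a p = toTopMk b p) : a = b := by
  obtain ⟨m, e, he, z, rfl⟩ := X.exists_nonDegenerate a
  obtain ⟨m', e', he', z', rfl⟩ := X.exists_nonDegenerate b
  have key (p : _root_.stdSimplex ℝ (Fin (n + 1))) (hp : ∀ i, 0 < p i) :
      (⟨m, z, _root_.stdSimplex.map e p⟩ : X.NonDegeneratePoint) =
        ⟨m', z', _root_.stdSimplex.map e' p⟩ :=
    IsNormalForm.eq_of_toTopMk_eq
      ⟨n, 𝟙 _, p, e, hp, stdSimplex.map_id_apply p, he, by simp, rfl⟩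
      ⟨n, 𝟙 _, p, e', hp, stdSimplex.map_id_apply p, he', by simp, rfl⟩ (h p)
  have h₀ := key stdSimplex.barycenter fun i ↦ by
    change (0 : ℝ) < (Fintype.card (Fin (n + 1)) : ℝ)⁻¹
    rw [Fintype.card_fin]
    positivity
  obtain rfl : m = m' := congrArg Sigma.fst h₀
  simp only [Sigma.mk.injEq, heq_eq_eq, true_and, Prod.mk.injEq] at h₀ key
  obtain rfl := h₀.1
  obtain rfl : e = e' := by
    ext t : 3
    exact congrFun (stdSimplex.eq_of_map_eq_of_pos (f := e) (g := e')
      fun p hp ↦ (key p hp).2) t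
  rfl

end SSet

/-- A morphism of simplicial sets is a monomorphism (equivalently, each of its
components `f_n : X_n → Y_n` is injective) if and only if the underlying
function of its geometric realization is injective. -/
theorem mono_iff_injective_toTop {X Y : SSet} (f : X ⟶ Y) :
    (∀ n : ℕ, Function.Injective (f.app (Opposite.op (SimplexCategory.mk n)))) ↔
      Function.Injective (SSet.toTop.map f) := by
  constructor
  · intro h
    have : Mono f := by
      rw [NatTrans.mono_iff_mono_app]
      intro n
      rw [CategoryTheory.mono_iff_injective]
      exact h n.unop.len
    exact SSet.toTop_map_injective f
  · intro h n a b hab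
    refine SSet.toTopMk_injective fun p ↦ h ?_
    rw [SSet.toTop_map_toTopMk, SSet.toTop_map_toTopMk, hab]
end

section
/- Let (L, R) be a weak factorization system on a category M and let W be a class of morphisms of M satisfying the 2-of-3 property (for composable f, g, if two of f, g, g∘f lie in W then so does the third). If L ⊆ W, then every morphism f ∈ W that has the left lifting property with respect to every morphism of R ∩ W belongs to L. -/
open CategoryTheory Limits

universe v₁ u₁ v₂ u₂ v₃ u₃ v₄ u₄

namespace InducedModel

/-- **Retract argument for intermediate weak factorization systems.** If
`(L, R)` is a weak factorization system, `W` satisfies 2-of-3, and `L ⊆ W`,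
then any `f ∈ W` having the left lifting property with respect to every
morphism of `R ⊓ W` belongs to `L`. -/
theorem mem_left_of_weq_llp
    {M : Type u₁} [Category.{v₁} M]
    (L R W : MorphismProperty M)
    (hwfs : IsWFS L R)
    (h23 : TwoOfThree W)
    (hLW : L ≤ W)
    ⦃X Y : M⦄ (f : X ⟶ Y) (hfW : W f)
    (hlift : ∀ ⦃A B : M⦄ (g : A ⟶ B), R g → W g → HasLiftingProperty f g) :
    L f := by
  obtain ⟨Z, i, p, hi, hp, hfac⟩ := hwfs.factor f
  have : HasLiftingProperty f p := hlift p hp (h23.2.2 i p (hLW i hi) (hfac ▸ hfW))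
  rw [hwfs.left_eq] at hi ⊢
  intro A B g hg
  have := hi g hg
  exact (RetractArrow.ofLeftLiftingProperty hfac).leftLiftingProperty g

end InducedModel
end
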